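/- Let 𝒳 = B_1 × ⋯ × B_s be a degenerate affine space over a field K of characteristic p, and assume p divides e_i = |B_i| for all i. Let I = I(𝒳), let ≺ be a graded monomial order, and let L have a basis of standard monomials A = {t^{a_1},…,t^{a_k}} ⊆ Δ_≺(I); set t^{b_i} = ∏_{j=1}^s t_j^{d_j − a_{i,j}} and B = {t^{b_1},…,t^{b_k}}. Then the following are equivalent: (a) A is weakly divisor-closed; (b) L^⊥ = K(Δ_≺(I) \ B); (c) (L_𝒳)^⊥ is a standard monomial code on 𝒳. -/

import Mathlib

open MvPolynomial

noncomputable section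

variable {K : Type*} [Field K] {s m : ℕ}

/-- Evaluation linear map at a family of points. -/
def evalMap (P : Fin m → (Fin s → K)) :
    MvPolynomial (Fin s) K →ₗ[K] (Fin m → K) :=
  LinearMap.pi fun i => (MvPolynomial.aeval (P i)).toLinearMap

/-- Vanishing ideal of a finite family of points. -/
def vanishingIdeal (P : Fin m → (Fin s → K)) : Ideal (MvPolynomial (Fin s) K) :=
  ⨅ i, RingHom.ker (MvPolynomial.eval (P i))

/-- The linear map `φ : f ↦ ∑ i, f(P i)`. -/
def sumEval (P : Fin m → (Fin s → K)) : MvPolynomial (Fin s) K →ₗ[K] K :=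
  ∑ i, (MvPolynomial.aeval (P i)).toLinearMap

/-- The leading exponent (initial monomial exponent) of a polynomial w.r.t. a monomial order. -/
def leadExpo (mo : MonomialOrder (Fin s)) (f : MvPolynomial (Fin s) K) : Fin s →₀ ℕ :=
  mo.toSyn.symm (f.support.sup fun a => mo.toSyn a)

/-- The initial ideal of `I` w.r.t. a monomial order. -/
def initialIdeal (mo : MonomialOrder (Fin s)) (I : Ideal (MvPolynomial (Fin s) K)) :
    Ideal (MvPolynomial (Fin s) K) :=
  Ideal.span ((fun f => (monomial (leadExpo mo f) (1 : K))) '' {f | f ∈ I ∧ f ≠ 0})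

/-- The set of exponents of standard monomials of `S/I`. -/
def stdMon (mo : MonomialOrder (Fin s)) (I : Ideal (MvPolynomial (Fin s) K)) :
    Set (Fin s →₀ ℕ) :=
  {a | monomial a (1 : K) ∉ initialIdeal mo I}

/-- `K Δ_≺(I)`, the span of the standard monomials. -/
def stdSpan (mo : MonomialOrder (Fin s)) (I : Ideal (MvPolynomial (Fin s) K)) :
    Submodule K (MvPolynomial (Fin s) K) :=
  Submodule.span K ((fun a => monomial a (1 : K)) '' stdMon mo I)

/-- The space `(ker φ : L) = {g | g·f ∈ ker φ for all f ∈ L}`. -/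
def colonKer (φ : MvPolynomial (Fin s) K →ₗ[K] K)
    (L : Submodule K (MvPolynomial (Fin s) K)) : Submodule K (MvPolynomial (Fin s) K) where
  carrier := {g | ∀ f ∈ L, φ (g * f) = 0}
  add_mem' := fun ha hb f hf => by rw [add_mul, map_add, ha f hf, hb f hf, add_zero]
  zero_mem' := fun f hf => by rw [zero_mul, map_zero]
  smul_mem' := fun c a ha f hf => by rw [smul_mul_assoc, map_smul, ha f hf, smul_zero]

/-- The algebraic dual `L^⊥ = (ker φ : L) ∩ KΔ_≺(I)`. -/
def algDual (P : Fin m → (Fin s → K)) (mo : MonomialOrder (Fin s))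
    (L : Submodule K (MvPolynomial (Fin s) K)) : Submodule K (MvPolynomial (Fin s) K) :=
  colonKer (sumEval P) L ⊓ stdSpan mo (vanishingIdeal P)

/-- The dual of a linear code in `K^m`. -/
def dualCode (C : Submodule K (Fin m → K)) : Submodule K (Fin m → K) where
  carrier := {α | ∀ β ∈ C, ∑ i, α i * β i = 0}
  add_mem' := fun ha hb β hβ => by
    simp only [Pi.add_apply, add_mul, Finset.sum_add_distrib]
    rw [ha β hβ, hb β hβ, add_zero]
  zero_mem' := fun β hβ => by simp
  smul_mem' := fun c a ha β hβ => by
    simp only [Pi.smul_apply, smul_eq_mul, mul_assoc, ← Finset.mul_sum]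
    rw [ha β hβ, mul_zero]

/-- Coordinatewise scaling of `K^m` by a vector `β`. -/
def scaleMap (β : Fin m → K) : (Fin m → K) →ₗ[K] (Fin m → K) :=
  LinearMap.pi fun i => β i • LinearMap.proj i

/-- A monomial order is graded if it refines total degree. -/
def MonomialOrder.IsGraded (mo : MonomialOrder (Fin s)) : Prop :=
  ∀ a b : Fin s →₀ ℕ, Finsupp.degree a < Finsupp.degree b → mo.toSyn a < mo.toSyn b

/-- The affine Hilbert function of the vanishing ideal of the points `P`. -/
def hilbA (P : Fin m → (Fin s → K)) (d : ℕ) : ℕ :=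
  Module.finrank K
    (Submodule.map (Ideal.Quotient.mkₐ K (vanishingIdeal P)).toLinearMap
      (restrictTotalDegree (Fin s) K d))

/-- The affine Hilbert function, with `H(d) = 0` for `d < 0`. -/
def hilbAZ (P : Fin m → (Fin s → K)) (d : ℤ) : ℕ :=
  if d < 0 then 0 else hilbA P d.toNat

/-- The Reed–Muller-type code of degree `d` on the points `P`. -/
def RMcode (P : Fin m → (Fin s → K)) (d : ℕ) : Submodule K (Fin m → K) :=
  Submodule.map (evalMap P) (restrictTotalDegree (Fin s) K d)

/-- The Reed–Muller-type code indexed by an integer degree, `⊥` for `d < 0`. -/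
def RMcodeZ (P : Fin m → (Fin s → K)) (d : ℤ) : Submodule K (Fin m → K) :=
  if d < 0 then ⊥ else RMcode P d.toNat

/-- The vanishing ideal of a single point. -/
def pointIdeal (Q : Fin s → K) : Ideal (MvPolynomial (Fin s) K) :=
  RingHom.ker (MvPolynomial.eval Q)

/-- The local v-number `v_𝔭(I)`. -/
def vNumAt (I 𝔭 : Ideal (MvPolynomial (Fin s) K)) : ℕ :=
  sInf {d | ∃ f : MvPolynomial (Fin s) K, f ≠ 0 ∧ f.totalDegree = d ∧
    I.colon (Ideal.span {f}) = 𝔭}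

/-- `f` is an indicator function for the `i`-th point. -/
def IsIndicator (P : Fin m → (Fin s → K)) (f : MvPolynomial (Fin s) K) (i : Fin m) : Prop :=
  MvPolynomial.eval (P i) f ≠ 0 ∧ ∀ j, j ≠ i → MvPolynomial.eval (P j) f = 0

/-- The minimum distance of a linear code. -/
def minDist (C : Submodule K (Fin m → K)) : ℕ :=
  sInf {w | ∃ v ∈ C, v ≠ 0 ∧ Set.ncard {i | v i ≠ 0} = w}

theorem mem_span_monomial_image {T : Set (Fin s →₀ ℕ)} {f : MvPolynomial (Fin s) K} :
    f ∈ Submodule.span K ((fun c => monomial c (1 : K)) '' T) ↔ ↑f.support ⊆ T := by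
  rw [← mem_restrictSupport_iff (R := K), restrictSupport_eq_span]

theorem monomial_mem_span {T : Set (Fin s →₀ ℕ)} {c : Fin s →₀ ℕ} :
    monomial c (1 : K) ∈ Submodule.span K ((fun c => monomial c (1 : K)) '' T) ↔ c ∈ T := by
  classical
  rw [mem_span_monomial_image, support_monomial, if_neg one_ne_zero]
  simp

theorem evalMap_apply (P : Fin m → (Fin s → K)) (f : MvPolynomial (Fin s) K) (i : Fin m) :
    evalMap P f i = eval (P i) f := by
  simp [evalMap, aeval_eq_eval]

theorem sumEval_apply (P : Fin m → (Fin s → K)) (f : MvPolynomial (Fin s) K) :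
    sumEval P f = ∑ i, eval (P i) f := by
  simp [sumEval, aeval_eq_eval]

theorem mem_vanishingIdeal {P : Fin m → (Fin s → K)} {f : MvPolynomial (Fin s) K} :
    f ∈ vanishingIdeal P ↔ ∀ i, eval (P i) f = 0 := by
  simp [_root_.vanishingIdeal]

theorem mem_stdMon {mo : MonomialOrder (Fin s)} {I : Ideal (MvPolynomial (Fin s) K)}
    {c : Fin s →₀ ℕ} :
    c ∈ stdMon mo I ↔ ∀ f ∈ I, f ≠ 0 → ¬ mo.degree f ≤ c := by
  classical
  have h : initialIdeal mo I = Ideal.span ((fun c => monomial c (1 : K)) ''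
      (mo.degree '' {f | f ∈ I ∧ f ≠ 0})) := by
    rw [Set.image_image]; rfl
  simp [stdMon, h, mem_ideal_span_monomial_image, support_monomial]

/-- A sum of powers over a finite subgroup of `Kˣ` with zero adjoined, when the characteristic
divides the number of summands. -/
theorem sum_pow_subgroup_insert_zero [Fintype K] (G : Subgroup Kˣ)
    (hG : (Nat.card G : K) + 1 = 0) (B : Finset K)
    (hB : ∀ x, x ∈ B ↔ x = 0 ∨ ∃ u ∈ G, (u : K) = x) (c : ℕ) :
    ∑ x ∈ B, x ^ c = if c ≠ 0 ∧ Nat.card G ∣ c then -1 else 0 := by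
  classical
  have hBeq : B = insert 0 (Finset.univ.image fun u : G => ((u : Kˣ) : K)) := by
    ext x; simp [hB]
  have hsum : ∑ x ∈ B, x ^ c = 0 ^ c + ∑ u : G, ((u : Kˣ) : K) ^ c := by
    rw [hBeq, Finset.sum_insert (by simp), Finset.sum_image]
    intro u _ v _ h
    exact Subtype.ext (Units.ext h)
  have hcard : (Nat.card G : K) = -1 := eq_neg_of_add_eq_zero_left hG
  have hmod : ∀ u : G, ((u : Kˣ) : K) ^ c = ((u : Kˣ) : K) ^ (c % Nat.card G) := by
    intro u
    have h : (u : G) ^ c = u ^ (c % Nat.card G) := (pow_mod_natCard u c).symm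
    exact_mod_cast congrArg (fun v : G => ((v : Kˣ) : K)) h
  rw [hsum]
  rcases eq_or_ne c 0 with rfl | hc
  · simp [← Nat.card_eq_fintype_card, hcard]
  · rw [zero_pow hc, zero_add, Finset.sum_congr rfl fun u _ => hmod u]
    by_cases hdvd : Nat.card G ∣ c
    · simp [Nat.mod_eq_zero_of_dvd hdvd, ← Nat.card_eq_fintype_card, hcard, hc, hdvd]
    · rw [if_neg fun h => hdvd h.2, FiniteField.sum_subgroup_pow_eq_zero]
      · exact fun h => hdvd (Nat.dvd_of_mod_eq_zero h)
      · rw [← Nat.card_eq_fintype_card]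
        exact Nat.mod_lt _ Nat.card_pos

theorem sumEval_monomial_ne_zero_iff [Fintype K] (A : Fin s → Subgroup Kˣ)
    (hA : ∀ j, (Nat.card (A j) : K) + 1 = 0) {P : Fin m → (Fin s → K)}
    (hP : Function.Injective P)
    (hrange : Set.range P =
      {x : Fin s → K | ∀ i, x i = 0 ∨ ∃ u ∈ A i, (u : K) = x i}) (c : Fin s →₀ ℕ) :
    sumEval P (monomial c 1) ≠ 0 ↔ ∀ j, c j ≠ 0 ∧ Nat.card (A j) ∣ c j := by
  classical
  let B : Fin s → Finset K := fun j => {x | x = 0 ∨ ∃ u ∈ A j, (u : K) = x}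
  have hB : ∀ j x, x ∈ B j ↔ x = 0 ∨ ∃ u ∈ A j, (u : K) = x := by simp [B]
  have himage : Finset.univ.image P = Fintype.piFinset B := by
    ext x
    have := Set.ext_iff.mp hrange x
    simpa [Fintype.mem_piFinset, hB] using this
  have hprod : sumEval P (monomial c 1) = ∏ j, ∑ x ∈ B j, x ^ c j := by
    rw [sumEval_apply, Finset.prod_univ_sum, ← himage, Finset.sum_image hP.injOn]
    exact Finset.sum_congr rfl fun i _ => by simp [eval_monomial, Finsupp.prod_fintype]
  rw [hprod, Finset.prod_ne_zero_iff]
  simp [fun j => sum_pow_subgroup_insert_zero (A j) (hA j) (B j) (hB j)]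

section Pairing

variable {φ : MvPolynomial (Fin s) K →ₗ[K] K} {d : Fin s → ℕ}

theorem le_of_apply_monomial_ne_zero
    (hφ : ∀ c : Fin s →₀ ℕ, φ (monomial c 1) ≠ 0 ↔ ∀ j, c j ≠ 0 ∧ d j ∣ c j)
    {c₀ a c : Fin s →₀ ℕ} (h : ∀ j, c₀ j + a j = d j) (hc : φ (monomial (c + a) 1) ≠ 0) :
    c₀ ≤ c := by
  intro j
  have hj := (hφ _).mp hc j
  have hle := Nat.le_of_dvd (Nat.pos_of_ne_zero hj.1) hj.2
  have := h j
  rw [Finsupp.add_apply] at hle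
  omega

theorem apply_monomial_add_ne_zero (hd : ∀ j, d j ≠ 0)
    (hφ : ∀ c : Fin s →₀ ℕ, φ (monomial c 1) ≠ 0 ↔ ∀ j, c j ≠ 0 ∧ d j ∣ c j)
    {c₀ a : Fin s →₀ ℕ} (h : ∀ j, c₀ j + a j = d j) : φ (monomial (c₀ + a) 1) ≠ 0 :=
  (hφ _).mpr fun j => by rw [Finsupp.add_apply, h]; exact ⟨hd j, dvd_rfl⟩

theorem apply_mul_monomial (f : MvPolynomial (Fin s) K) (a : Fin s →₀ ℕ) :
    φ (f * monomial a 1) = ∑ c ∈ f.support, coeff c f * φ (monomial (c + a) 1) := by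
  conv_lhs => rw [f.as_sum]
  rw [Finset.sum_mul, map_sum]
  refine Finset.sum_congr rfl fun c _ => ?_
  rw [monomial_mul, ← smul_eq_mul (coeff c f) (φ _), ← map_smul, smul_monomial, smul_eq_mul]

theorem apply_mul_monomial_ne_zero (hd : ∀ j, d j ≠ 0)
    (hφ : ∀ c : Fin s →₀ ℕ, φ (monomial c 1) ≠ 0 ↔ ∀ j, c j ≠ 0 ∧ d j ∣ c j)
    {f : MvPolynomial (Fin s) K} {c₀ a : Fin s →₀ ℕ} (hc₀ : c₀ ∈ f.support)
    (h : ∀ j, c₀ j + a j = d j)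
    (huniq : ∀ c ∈ f.support, φ (monomial (c + a) 1) ≠ 0 → c = c₀) :
    φ (f * monomial a 1) ≠ 0 := by
  rw [apply_mul_monomial, Finset.sum_eq_single_of_mem c₀ hc₀]
  · exact mul_ne_zero (mem_support_iff.mp hc₀) (apply_monomial_add_ne_zero hd hφ h)
  · intro c hc hne
    rw [not_imp_comm.mp (huniq c hc) hne, mul_zero]

theorem mem_colonKer_span_range_iff {k : ℕ} {a : Fin k → (Fin s →₀ ℕ)}
    {g : MvPolynomial (Fin s) K} :
    g ∈ colonKer φ (Submodule.span K (Set.range fun i => monomial (a i) (1 : K))) ↔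
      ∀ i, φ (g * monomial (a i) 1) = 0 := by
  refine ⟨fun h i => h _ (Submodule.subset_span ⟨i, rfl⟩), fun h f hf => ?_⟩
  have hle : Submodule.span K (Set.range fun i => monomial (a i) (1 : K)) ≤
      LinearMap.ker (φ ∘ₗ LinearMap.mulLeft K g) := by
    rw [Submodule.span_le]
    rintro _ ⟨i, rfl⟩
    exact h i
  exact hle hf

end Pairing

theorem mem_stdMon_vanishingIdeal_iff {P : Fin m → (Fin s → K)} {d : Fin s → ℕ}
    (hd : ∀ j, d j ≠ 0)
    (hφ : ∀ c : Fin s →₀ ℕ, sumEval P (monomial c 1) ≠ 0 ↔ ∀ j, c j ≠ 0 ∧ d j ∣ c j)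
    (hpow : ∀ i j, P i j = 0 ∨ P i j ^ d j = 1) (mo : MonomialOrder (Fin s))
    {c : Fin s →₀ ℕ} :
    c ∈ stdMon mo (vanishingIdeal P) ↔ ∀ j, c j ≤ d j := by
  classical
  rw [mem_stdMon]
  constructor
  · intro h j
    by_contra! hj
    obtain ⟨c', hadd⟩ : ∃ c', c' + Finsupp.single j (d j) = c :=
      ⟨_, tsub_add_cancel_of_le (Finsupp.single_le_iff.mpr hj.le)⟩
    have hlt : c' < c := by
      rw [← hadd]
      exact lt_add_of_pos_right _ (pos_iff_ne_zero.mpr (Finsupp.single_ne_zero.mpr (hd j)))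
    have hdeg : mo.degree (monomial c (1 : K) - monomial c' 1) = c := by
      rw [mo.degree_sub_of_lt] <;> simp only [mo.degree_monomial, one_ne_zero, if_false]
      exact mo.toSyn_strictMono hlt
    refine h (monomial c 1 - monomial c' 1) (mem_vanishingIdeal.mpr fun i => ?_) ?_ hdeg.le
    · have hmul : monomial c (1 : K) = monomial c' 1 * monomial (Finsupp.single j (d j)) 1 := by
        rw [monomial_mul, hadd, one_mul]
      rw [map_sub, hmul, map_mul, sub_eq_zero]
      rcases hpow i j with h0 | h1
      · have hc'j : c' j ≠ 0 := by
          have := DFunLike.congr_fun hadd j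
          rw [Finsupp.add_apply, Finsupp.single_eq_same] at this
          omega
        have : eval (P i) (monomial c' (1 : K)) = 0 := by
          rw [eval_monomial, one_mul, Finsupp.prod_fintype _ _ (by simp)]
          exact Finset.prod_eq_zero (Finset.mem_univ j) (by rw [h0, zero_pow hc'j])
        rw [this, zero_mul]
      · simp [eval_monomial, h1]
    · rw [sub_ne_zero]
      exact fun heq => hlt.ne' (monomial_left_injective one_ne_zero heq)
  · intro h f hf hf0 hle
    let a : Fin s →₀ ℕ := Finsupp.equivFunOnFinite.symm fun j => d j - mo.degree f j
    have ha : ∀ j, mo.degree f j + a j = d j := fun j =>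
      Nat.add_sub_cancel' ((hle j).trans (h j))
    refine apply_mul_monomial_ne_zero hd hφ (mo.degree_mem_support hf0) ha (fun c' hc' hne => ?_)
      ?_
    · have h₁ := mo.toSyn_monotone (le_of_apply_monomial_ne_zero hφ ha hne)
      exact mo.toSyn.injective (le_antisymm (mo.le_degree hc') h₁)
    · rw [sumEval_apply]
      exact Finset.sum_eq_zero fun i _ => by rw [map_mul, mem_vanishingIdeal.mp hf i, zero_mul]

theorem evalMap_injOn_stdSpan (P : Fin m → (Fin s → K)) (mo : MonomialOrder (Fin s)) :
    Set.InjOn (evalMap P) (stdSpan mo (vanishingIdeal P)) := by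
  intro f hf g hg h
  by_contra hne
  have hsub : f - g ≠ 0 := sub_ne_zero.mpr hne
  have hmem := mem_span_monomial_image.mp (sub_mem hf hg) (mo.degree_mem_support hsub)
  refine mem_stdMon.mp hmem (f - g) (mem_vanishingIdeal.mpr fun i => ?_) hsub le_rfl
  rw [map_sub, ← evalMap_apply, ← evalMap_apply, h, sub_self]

theorem exists_reduced_exponent {d : ℕ} (hd : d ≠ 0) (n : ℕ) :
    ∃ r ≤ d, ∀ x : K, x = 0 ∨ x ^ d = 1 → x ^ r = x ^ n := by
  induction n using Nat.strong_induction_on with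
  | _ n ih =>
    rcases le_or_gt n d with h | h
    · exact ⟨n, h, fun _ _ => rfl⟩
    · obtain ⟨r, hr, hrx⟩ := ih (n - d) (by omega)
      refine ⟨r, hr, fun x hx => ?_⟩
      rw [hrx x hx]
      rcases hx with rfl | hx
      · rw [zero_pow (by omega), zero_pow (by omega)]
      · conv_rhs => rw [← Nat.sub_add_cancel h.le, pow_add, hx, mul_one]

theorem exists_evalMap_eq [Fintype K] {P : Fin m → (Fin s → K)} (hP : Function.Injective P)
    {d : Fin s → ℕ} (hd : ∀ j, d j ≠ 0) (hpow : ∀ i j, P i j = 0 ∨ P i j ^ d j = 1)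
    (v : Fin m → K) :
    ∃ g ∈ Submodule.span K ((fun c => monomial c (1 : K)) '' {c | ∀ j, c j ≤ d j}),
      evalMap P g = v := by
  classical
  set V := Submodule.span K ((fun c => monomial c (1 : K)) '' {c | ∀ j, c j ≤ d j})
  have hmon : ∀ c : Fin s →₀ ℕ, evalMap P (monomial c 1) ∈ V.map (evalMap P) := by
    intro c
    choose r hr hrx using fun j => exists_reduced_exponent (K := K) (hd j) (c j)
    refine ⟨monomial (Finsupp.equivFunOnFinite.symm r) 1, monomial_mem_span.mpr hr, ?_⟩
    ext i
    simp only [evalMap_apply, eval_monomial, one_mul]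
    rw [Finsupp.prod_fintype _ _ (by simp), Finsupp.prod_fintype _ _ (by simp)]
    exact Finset.prod_congr rfl fun j _ => hrx j _ (hpow i j)
  have hall : ∀ f, evalMap P f ∈ V.map (evalMap P) := by
    intro f
    rw [f.as_sum, map_sum]
    refine sum_mem fun c _ => ?_
    rw [← mul_one (coeff c f), ← smul_eq_mul, ← smul_monomial, map_smul]
    exact Submodule.smul_mem _ _ (hmon c)
  have hmem : Function.extend P v 0 ∈ (⊤ : Submodule K ((Fin s → K) → K)) := trivial
  rw [← map_restrict_dom_evalₗ K (Fin s)] at hmem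
  obtain ⟨f, -, hf⟩ := hmem
  have hv : evalMap P f = v := by
    ext i
    rw [evalMap_apply, ← evalₗ_apply, hf, hP.extend_apply]
  rw [← hv]
  exact hall f

theorem map_evalMap_algDual {P : Fin m → (Fin s → K)} {mo : MonomialOrder (Fin s)}
    (hsurj : ∀ v, ∃ g ∈ stdSpan mo (vanishingIdeal P), evalMap P g = v)
    (L : Submodule K (MvPolynomial (Fin s) K)) :
    (algDual P mo L).map (evalMap P) = dualCode (L.map (evalMap P)) := by
  have hpair : ∀ f g, sumEval P (g * f) = ∑ i, evalMap P g i * evalMap P f i := by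
    intro f g
    simp [sumEval_apply, evalMap_apply]
  ext v
  constructor
  · rintro ⟨g, hg, rfl⟩ _ ⟨f, hf, rfl⟩
    rw [← hpair]
    exact hg.1 f hf
  · intro hv
    obtain ⟨g, hg, rfl⟩ := hsurj v
    exact ⟨g, ⟨fun f hf => (hpair f g).trans (hv _ ⟨f, hf, rfl⟩), hg⟩, rfl⟩

/-- Classification of when the dual of a monomial code on a degenerate affine space is a
standard monomial code. -/
theorem dual_degenerate_affine_space [Fintype K] (p : ℕ) (hp : p.Prime) (hchar : CharP K p)
    (A : Fin s → Subgroup Kˣ) (d : Fin s → ℕ) (hd : ∀ i, d i = Nat.card (A i))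
    (e : Fin s → ℕ) (he : ∀ i, e i = d i + 1) (hpe : ∀ i, p ∣ e i)
    (P : Fin m → (Fin s → K)) (hP : Function.Injective P)
    (hrange : Set.range P =
      {x : Fin s → K | ∀ i, x i = 0 ∨ ∃ u ∈ A i, (u : K) = x i})
    (mo : MonomialOrder (Fin s)) (hmo : mo.IsGraded)
    {k : ℕ} (a : Fin k → (Fin s →₀ ℕ)) (hainj : Function.Injective a)
    (ha : ∀ i, a i ∈ stdMon mo (vanishingIdeal P))
    (b : Fin k → (Fin s →₀ ℕ)) (hb : ∀ i j, b i j = d j - a i j) :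
    ((∀ i : Fin k, ∀ D : Set (Fin s), (∀ j ∈ D, a i j = d j) →
        ∃ i' : Fin k, (∀ j ∈ D, a i' j = 0) ∧ ∀ j ∉ D, a i' j = a i j) ↔
      algDual P mo (Submodule.span K (Set.range fun i => monomial (a i) (1 : K))) =
        Submodule.span K
          ((fun c => monomial c (1 : K)) ''
            (stdMon mo (vanishingIdeal P) \ Set.range b))) ∧
    ((algDual P mo (Submodule.span K (Set.range fun i => monomial (a i) (1 : K))) =
        Submodule.span K
          ((fun c => monomial c (1 : K)) ''
            (stdMon mo (vanishingIdeal P) \ Set.range b))) ↔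
      ∃ Γ : Set (Fin s →₀ ℕ), Γ ⊆ stdMon mo (vanishingIdeal P) ∧
        Submodule.map (evalMap P)
            (Submodule.span K ((fun c => monomial c (1 : K)) '' Γ)) =
          dualCode (Submodule.map (evalMap P)
            (Submodule.span K (Set.range fun i => monomial (a i) (1 : K))))) := by
  classical
  have hA : ∀ j, (Nat.card (A j) : K) + 1 = 0 := by
    intro j
    have := (CharP.cast_eq_zero_iff K p (e j)).mpr (hpe j)
    rw [he, hd] at this
    exact_mod_cast this
  have hd0 : ∀ j, d j ≠ 0 := fun j => by rw [hd]; exact Nat.card_pos.ne'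
  have hφ : ∀ c : Fin s →₀ ℕ, sumEval P (monomial c 1) ≠ 0 ↔ ∀ j, c j ≠ 0 ∧ d j ∣ c j := by
    intro c
    simpa only [hd] using sumEval_monomial_ne_zero_iff A hA hP hrange c
  have hpow : ∀ i j, P i j = 0 ∨ P i j ^ d j = 1 := by
    intro i j
    have hi : P i ∈ Set.range P := ⟨i, rfl⟩
    rw [hrange] at hi
    refine (hi j).imp_right ?_
    rintro ⟨u, hu, hux⟩
    rw [← hux, hd]
    have hone : u ^ Nat.card (A j) = 1 :=
      congrArg Subtype.val (pow_card_eq_one' (x := (⟨u, hu⟩ : A j)))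
    rw [← Units.val_pow_eq_pow_val, hone, Units.val_one]
  have hstd : ∀ {c}, c ∈ stdMon mo (vanishingIdeal P) ↔ ∀ j, c j ≤ d j :=
    mem_stdMon_vanishingIdeal_iff hd0 hφ hpow mo
  have hab : ∀ i j, b i j + a i j = d j := fun i j => by
    rw [hb]; exact Nat.sub_add_cancel (hstd.mp (ha i) j)
  have hbinj : ∀ {i i'}, b i = b i' → a i = a i' := by
    intro i i' h
    ext j
    have h₁ := hab i j
    have h₂ := hab i' j
    rw [h] at h₁
    omega
  have hbstd : ∀ i, b i ∈ stdMon mo (vanishingIdeal P) := fun i =>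
    hstd.mpr fun j => (Nat.le_add_right _ _).trans_eq (hab i j)
  have hsurj : ∀ v, ∃ g ∈ stdSpan mo (vanishingIdeal P), evalMap P g = v := by
    intro v
    have hset : stdMon mo (vanishingIdeal P) = {c | ∀ j, c j ≤ d j} := Set.ext fun _ => hstd
    rw [stdSpan, hset]
    exact exists_evalMap_eq hP hd0 hpow v
  have hdual : ∀ g, g ∈ algDual P mo (Submodule.span K (Set.range fun i => monomial (a i) 1)) ↔
      (∀ i, sumEval P (g * monomial (a i) 1) = 0) ∧ g ∈ stdSpan mo (vanishingIdeal P) :=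
    fun g => and_congr_left fun _ => mem_colonKer_span_range_iff
  have hdual_mon : ∀ {c}, monomial c 1 ∈ algDual P mo
      (Submodule.span K (Set.range fun i => monomial (a i) 1)) ↔
      (∀ i, sumEval P (monomial (c + a i) 1) = 0) ∧ c ∈ stdMon mo (vanishingIdeal P) := by
    intro c
    rw [hdual, stdSpan, monomial_mem_span]
    simp only [monomial_mul, one_mul]
  have hcode := map_evalMap_algDual hsurj (Submodule.span K (Set.range fun i => monomial (a i) 1))
  refine ⟨⟨fun hdiv => ?_, fun heq i D hD => ?_⟩, fun heq => ?_, ?_⟩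
  · have hpair : ∀ c, (∀ j, c j ≤ d j) → ∀ i, sumEval P (monomial (c + a i) 1) ≠ 0 →
        c ∈ Set.range b := by
      intro c hc i hne
      obtain ⟨i', h₁, h₂⟩ := hdiv i {j | a i j = d j ∧ c j = d j} fun j hj => hj.1
      refine ⟨i', Finsupp.ext fun j => ?_⟩
      have hi' := hab i' j
      by_cases hj : a i j = d j ∧ c j = d j
      · rw [h₁ j hj] at hi'
        exact hi'.trans hj.2.symm
      · rw [h₂ j hj] at hi'
        obtain ⟨hne0, t, ht⟩ := (hφ _).mp hne j
        rw [Finsupp.add_apply] at hne0 ht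
        have haj := hstd.mp (ha i) j
        have hcj := hc j
        have ht1 : t = 1 := by
          rcases t with _ | _ | t
          · omega
          · rfl
          · have : d j * (t + 1 + 1) = d j * t + d j + d j := by ring
            omega
        subst ht1
        omega
    ext g
    rw [hdual, mem_span_monomial_image, stdSpan, mem_span_monomial_image]
    constructor
    · rintro ⟨hg, hgs⟩ c hc
      refine ⟨hgs hc, fun hcb => ?_⟩
      obtain ⟨c₀, hc₀⟩ := (g.support.filter (· ∈ Set.range b)).exists_maximal
        ⟨c, Finset.mem_filter.mpr ⟨hc, hcb⟩⟩
      obtain ⟨hc₀s, i, rfl⟩ := Finset.mem_filter.mp hc₀.prop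
      refine apply_mul_monomial_ne_zero hd0 hφ hc₀s (hab i) (fun c' hc' hne => ?_) (hg i)
      have hmem := hpair c' (hstd.mp (hgs hc')) i hne
      exact (hc₀.eq_of_le (Finset.mem_filter.mpr ⟨hc', hmem⟩)
        (le_of_apply_monomial_ne_zero hφ (hab i) hne)).symm
    · intro hg
      refine ⟨fun i => ?_, fun c hc => (hg hc).1⟩
      rw [apply_mul_monomial]
      refine Finset.sum_eq_zero fun c hc => ?_
      rw [not_not.mp (mt (hpair c (hstd.mp (hg hc).1) i) (hg hc).2), mul_zero]
  · let c : Fin s →₀ ℕ := Finsupp.equivFunOnFinite.symm fun j => if j ∈ D then d j else b i j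
    have hcj : ∀ j, c j = if j ∈ D then d j else b i j := fun j => rfl
    have hcs : c ∈ stdMon mo (vanishingIdeal P) := hstd.mpr fun j => by
      rw [hcj]
      have := hab i j
      split_ifs <;> omega
    have hne : sumEval P (monomial (c + a i) 1) ≠ 0 := (hφ _).mpr fun j => by
      rw [Finsupp.add_apply, hcj]
      split_ifs with hj
      · rw [hD j hj]
        exact ⟨by have := hd0 j; omega, dvd_add dvd_rfl dvd_rfl⟩
      · rw [hab]
        exact ⟨hd0 j, dvd_rfl⟩
    have hcb : c ∈ Set.range b := by
      by_contra hcb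
      have hmem := (monomial_mem_span (K := K)).mpr
        (Set.mem_sdiff_of_mem hcs hcb)
      rw [← heq] at hmem
      exact hne ((hdual_mon.mp hmem).1 i)
    obtain ⟨i', hi'⟩ := hcb
    refine ⟨i', fun j hj => ?_, fun j hj => ?_⟩ <;>
    · have h₁ := hab i' j
      have h₂ := hab i j
      rw [hi', hcj] at h₁
      simp only [hj, if_true, if_false] at h₁
      omega
  · exact ⟨_, Set.sdiff_subset, by rw [← heq, hcode]⟩
  · rintro ⟨Γ, hΓ, hΓcode⟩
    have hΓdual : algDual P mo (Submodule.span K (Set.range fun i => monomial (a i) 1)) =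
        Submodule.span K ((fun c => monomial c (1 : K)) '' Γ) := by
      have hΓle : Submodule.span K ((fun c => monomial c (1 : K)) '' Γ) ≤
          stdSpan mo (vanishingIdeal P) := Submodule.span_mono (Set.image_mono hΓ)
      rw [← hcode] at hΓcode
      ext g
      constructor
      · intro hg
        obtain ⟨g', hg', h⟩ := hΓcode.ge ⟨g, hg, rfl⟩
        rwa [← evalMap_injOn_stdSpan P mo (hΓle hg') hg.2 h]
      · intro hg
        obtain ⟨g', hg', h⟩ := hΓcode.le ⟨g, hg, rfl⟩
        rwa [← evalMap_injOn_stdSpan P mo hg'.2 (hΓle hg) h]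
    have hbΓ : ∀ i, b i ∉ Γ := by
      intro i hi
      have hmem := (monomial_mem_span (K := K)).mpr hi
      rw [← hΓdual] at hmem
      exact apply_monomial_add_ne_zero hd0 hφ (hab i) ((hdual_mon.mp hmem).1 i)
    rw [hΓdual]
    congr 2
    refine Set.Subset.antisymm (fun c hc => ⟨hΓ hc, ?_⟩) ?_
    · rintro ⟨i, rfl⟩
      exact hbΓ i hc
    · rintro c ⟨hcs, hcb⟩
      let T : Option (Fin k) → (Fin s →₀ ℕ) := fun o => o.elim c b
      have hTinj : Function.Injective T := by
        rintro (_ | i) (_ | i') h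
        · rfl
        · exact absurd ⟨i', h.symm⟩ hcb
        · exact absurd ⟨i, h⟩ hcb
        · rw [hainj (hbinj h)]
      let comb : (Option (Fin k) → K) →ₗ[K] MvPolynomial (Fin s) K :=
        Fintype.linearCombination K fun o => monomial (T o) (1 : K)
      let F : (Option (Fin k) → K) →ₗ[K] (Fin k → K) :=
        LinearMap.pi fun i => sumEval P ∘ₗ LinearMap.mulRight K (monomial (a i) 1) ∘ₗ comb
      have hker : LinearMap.ker F ≠ ⊥ := F.ker_ne_bot_of_finrank_lt (by simp)
      obtain ⟨x, hx, hx0⟩ := (Submodule.ne_bot_iff _).mp hker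
      have hcoeff : ∀ o, coeff (T o) (comb x) = x o := by
        intro o
        simp [comb, Fintype.linearCombination_apply, coeff_sum, coeff_smul, coeff_monomial,
          hTinj.eq_iff, -Fintype.sum_option]
      have hmem : comb x ∈ algDual P mo
          (Submodule.span K (Set.range fun i => monomial (a i) 1)) := by
        rw [hdual]
        refine ⟨fun i => congrFun hx i, ?_⟩
        rw [Fintype.linearCombination_apply]
        refine sum_mem fun o _ => Submodule.smul_mem _ _ (monomial_mem_span.mpr ?_)
        cases o
        · exact hcs
        · exact hbstd _
      rw [hΓdual, mem_span_monomial_image] at hmem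
      obtain ⟨o, ho⟩ := Function.ne_iff.mp hx0
      have hoΓ : T o ∈ Γ := hmem (by rw [Finset.mem_coe, mem_support_iff, hcoeff]; exact ho)
      cases o
      · exact hoΓ
      · exact absurd hoΓ (hbΓ _)

end
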